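/- Assume (A1), (A2) and the normalization ψ(ξ) = 1 for |ξ| = 1. For s ≥ 1 set ν^s(z) = s · ψ^{-1}(1/s)^{-d} · ν(z/ψ^{-1}(1/s)) and h^s(r) = ∫_{ℝ^d} (|z|²/r² ∧ 1) ν^s(z) dz. Then for every r > 0, lim_{s→∞} h^s(r) = ∫_{ℝ^d} (|z|²/r² ∧ 1) 𝒜(d,α)|z|^{-d-α} dz. -/

import Mathlib

open MeasureTheory Filter Real
open scoped RealInnerProductSpace

noncomputable section

/-- Pruitt's concentration function `K(r) = r⁻² ∫_{|z|<r} |z|² ν(|z|) dz`. -/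
def K (d : ℕ) (ν : ℝ → ℝ) (r : ℝ) : ℝ :=
  (∫ z in Metric.ball (0 : EuclideanSpace ℝ (Fin d)) r, ‖z‖ ^ 2 * ν ‖z‖) / r ^ 2

/-- Pruitt's concentration function `h(r) = ∫ (|z|²/r² ∧ 1) ν(|z|) dz`. -/
def hfun (d : ℕ) (ν : ℝ → ℝ) (r : ℝ) : ℝ :=
  ∫ z : EuclideanSpace ℝ (Fin d), min (‖z‖ ^ 2 / r ^ 2) 1 * ν ‖z‖

/-- The characteristic (Lévy–Khintchine) exponent `ψ(ξ) = ∫ (1 - cos⟪ξ,z⟫) ν(|z|) dz`. -/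
def ψ (d : ℕ) (ν : ℝ → ℝ) (ξ : EuclideanSpace ℝ (Fin d)) : ℝ :=
  ∫ z : EuclideanSpace ℝ (Fin d), (1 - Real.cos ⟪ξ, z⟫) * ν ‖z‖

/-- The radial nondecreasing majorant `ψ*(r) = sup_{|z| ≤ r} ψ(z)`. -/
def ψstar (d : ℕ) (ν : ℝ → ℝ) (r : ℝ) : ℝ :=
  sSup {y : ℝ | ∃ z : EuclideanSpace ℝ (Fin d), ‖z‖ ≤ r ∧ ψ d ν z = y}

/-- The generalized inverse `ψ⁻¹(u) = sup {r ≥ 0 : ψ*(r) = u}`. -/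
def ψinv (d : ℕ) (ν : ℝ → ℝ) (u : ℝ) : ℝ :=
  sSup {r : ℝ | 0 ≤ r ∧ ψstar d ν r = u}

/-- Characteristic exponent `ψˢ(ξ) = s·ψ(ψ⁻¹(1/s)ξ)` of the rescaled process. -/
def ψs (d : ℕ) (ν : ℝ → ℝ) (s : ℝ) (ξ : EuclideanSpace ℝ (Fin d)) : ℝ :=
  s * ψ d ν (ψinv d ν (1 / s) • ξ)

/-- Lévy density `νˢ(x) = s·ψ⁻¹(1/s)^{-d}·ν(x/ψ⁻¹(1/s))` of the rescaled process. -/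
def νs (d : ℕ) (ν : ℝ → ℝ) (s : ℝ) (x : EuclideanSpace ℝ (Fin d)) : ℝ :=
  s / ψinv d ν (1 / s) ^ d * ν (‖x‖ / ψinv d ν (1 / s))

/-- `ψ^{-1,s}(u) = ψ⁻¹(u/s)/ψ⁻¹(1/s)`. -/
def ψinvs (d : ℕ) (ν : ℝ → ℝ) (s u : ℝ) : ℝ :=
  ψinv d ν (u / s) / ψinv d ν (1 / s)

/-- The stable constant `𝒜(d,α)`. -/
def Aconst (d : ℕ) (α : ℝ) : ℝ :=
  α * (2 : ℝ) ^ (α - 1) * Real.Gamma (((d : ℝ) + α) / 2) /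
    (Real.Gamma (1 - α / 2) * Real.pi ^ ((d : ℝ) / 2))

/-- Heat kernel of the rescaled process, via Fourier inversion. -/
def pts (d : ℕ) (ν : ℝ → ℝ) (s t : ℝ) (x : EuclideanSpace ℝ (Fin d)) : ℝ :=
  ((2 * Real.pi) ^ d)⁻¹ *
    ∫ ξ : EuclideanSpace ℝ (Fin d), Real.cos ⟪ξ, x⟫ * Real.exp (-(t * ψs d ν s ξ))

/-- Heat kernel of the isotropic α-stable process. -/
def ptα (d : ℕ) (α t : ℝ) (x : EuclideanSpace ℝ (Fin d)) : ℝ :=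
  ((2 * Real.pi) ^ d)⁻¹ *
    ∫ ξ : EuclideanSpace ℝ (Fin d), Real.cos ⟪ξ, x⟫ * Real.exp (-(t * ‖ξ‖ ^ α))

/-- Heat kernel of the original process, via Fourier inversion. -/
def pt (d : ℕ) (ν : ℝ → ℝ) (t : ℝ) (x : EuclideanSpace ℝ (Fin d)) : ℝ :=
  ((2 * Real.pi) ^ d)⁻¹ *
    ∫ ξ : EuclideanSpace ℝ (Fin d), Real.cos ⟪ξ, x⟫ * Real.exp (-(t * ψ d ν ξ))

/-- A nonnegative function with nonzero Bochner integral has the same Lebesgue integral. -/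
lemma lintegral_ofReal_eq_of_integral_eq {X : Type*} [MeasurableSpace X] {μ : Measure X}
    {f : X → ℝ} {c : ℝ} (hf : 0 ≤ᵐ[μ] f) (hc : c ≠ 0) (h : ∫ x, f x ∂μ = c) :
    ∫⁻ x, ENNReal.ofReal (f x) ∂μ = ENNReal.ofReal c := by
  rw [← h, ofReal_integral_eq_lintegral_ofReal
    (Integrable.of_integral_ne_zero (by rwa [h])) hf]

/-- `y ^ (-p)` as a mixture of `exp (-y / u)`. -/
lemma lintegral_rpow_mul_exp_neg_div {p y : ℝ} (hp : 0 < p) (hy : 0 < y) :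
    ∫⁻ u in Set.Ioi (0 : ℝ), ENNReal.ofReal (u ^ (-p - 1) * exp (-(y / u))) =
      ENNReal.ofReal (Gamma p * y ^ (-p)) := by
  refine lintegral_ofReal_eq_of_integral_eq ?_ ?_ ?_
  · filter_upwards [ae_restrict_mem measurableSet_Ioi] with u hu
    have hu' : (0 : ℝ) < u := hu
    simp only [Pi.zero_apply]
    positivity
  · have := Gamma_pos_of_pos hp
    positivity
  · have h := integral_comp_rpow_Ioi (fun t : ℝ => t ^ (p - 1) * exp (-(y * t)))
      (p := -1) (by norm_num)
    rw [integral_rpow_mul_exp_neg_mul_Ioi hp hy] at h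
    rw [rpow_neg hy.le, ← inv_rpow hy.le, inv_eq_one_div, mul_comm, ← h]
    refine setIntegral_congr_fun measurableSet_Ioi fun u hu => ?_
    have hu' : (0 : ℝ) < u := hu
    simp only [smul_eq_mul, abs_neg, abs_one, one_mul]
    rw [← rpow_mul hu'.le, ← mul_assoc, ← rpow_add hu', rpow_neg_one, div_eq_mul_inv]
    ring_nf

lemma lintegral_rpow_mul_one_sub_exp {a c : ℝ} (ha : 0 < a) (ha1 : a < 1) (hc : 0 ≤ c) :
    ∫⁻ u in Set.Ioi (0 : ℝ), ENNReal.ofReal (u ^ (-a - 1) * (1 - exp (-(c * u)))) =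
      ENNReal.ofReal (Gamma (1 - a) * c ^ a / a) := by
  have hΓ : 0 < Gamma (1 - a) := Gamma_pos_of_pos (by linarith)
  have inner : ∀ u ∈ Set.Ioi (0 : ℝ), ENNReal.ofReal (u ^ (-a - 1) * (1 - exp (-(c * u)))) =
      ∫⁻ x in Set.Ioc 0 c, ENNReal.ofReal (u ^ (-a) * exp (-(u * x))) := by
    intro u hu
    have hu' : (0 : ℝ) < u := hu
    rw [← ofReal_integral_eq_lintegral_ofReal]
    · congr 1
      rw [← intervalIntegral.integral_of_le hc, intervalIntegral.integral_const_mul]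
      have : ∫ x in (0 : ℝ)..c, exp (-(u * x)) = (1 - exp (-(c * u))) / u := by
        rw [intervalIntegral.integral_eq_sub_of_hasDerivAt
          (f := fun x => -exp (-(u * x)) / u)]
        · simp
          ring_nf
        · intro x _
          have h1 : HasDerivAt (fun x : ℝ => -(u * x)) (-(u * 1)) x :=
            ((hasDerivAt_id x).const_mul u).neg
          refine ((h1.exp.neg).div_const u).congr_deriv ?_
          field_simp
        · exact Continuous.intervalIntegrable (by fun_prop) _ _
      rw [this, rpow_sub_one hu'.ne']
      ring
    · exact (Continuous.integrableOn_Ioc (by fun_prop))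
    · exact Eventually.of_forall fun x => by simp only [Pi.zero_apply]; positivity
  rw [setLIntegral_congr_fun measurableSet_Ioi inner, lintegral_lintegral_swap]
  · have outer : ∀ x ∈ Set.Ioc (0 : ℝ) c,
        ∫⁻ u in Set.Ioi (0 : ℝ), ENNReal.ofReal (u ^ (-a) * exp (-(u * x))) =
          ENNReal.ofReal (Gamma (1 - a) * x ^ (a - 1)) := by
      intro x hx
      have hx0 : 0 < x := hx.1
      refine lintegral_ofReal_eq_of_integral_eq ?_ (by positivity) ?_
      · filter_upwards [ae_restrict_mem measurableSet_Ioi] with u hu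
        have hu' : (0 : ℝ) < u := hu
        simp only [Pi.zero_apply]
        positivity
      · have h := integral_rpow_mul_exp_neg_mul_Ioi (a := 1 - a) (by linarith) hx0
        rw [one_div, inv_rpow hx0.le, ← rpow_neg hx0.le] at h
        rw [mul_comm, show a - 1 = -(1 - a) by ring, ← h]
        refine setIntegral_congr_fun measurableSet_Ioi fun u _ => ?_
        ring_nf
    rw [setLIntegral_congr_fun measurableSet_Ioc outer, ← ofReal_integral_eq_lintegral_ofReal]
    · congr 1
      rw [← intervalIntegral.integral_of_le hc, intervalIntegral.integral_const_mul,
        integral_rpow (Or.inl (by linarith))]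
      simp [ha.ne', mul_div_assoc]
    · exact ((intervalIntegral.intervalIntegrable_rpow' (by linarith)).1).const_mul _
    · filter_upwards [ae_restrict_mem measurableSet_Ioc] with x hx
      have := hx.1
      simp only [Pi.zero_apply]
      positivity
  · exact (Measurable.aemeasurable (by fun_prop))

lemma integral_one_sub_cos_mul_gaussian {d : ℕ} (ξ : EuclideanSpace ℝ (Fin d)) {u : ℝ}
    (hu : 0 < u) :
    Integrable (fun w : EuclideanSpace ℝ (Fin d) =>
        (1 - cos ⟪ξ, w⟫) * exp (-(‖w‖ ^ 2 / u))) ∧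
      ∫ w : EuclideanSpace ℝ (Fin d), (1 - cos ⟪ξ, w⟫) * exp (-(‖w‖ ^ 2 / u)) =
        (π * u) ^ ((d : ℝ) / 2) * (1 - exp (-(‖ξ‖ ^ 2 / 4 * u))) := by
  have hb : 0 < ((u⁻¹ : ℝ) : ℂ).re := by simpa using hu
  have key : ∀ w : EuclideanSpace ℝ (Fin d),
      RCLike.re (Complex.exp (-((u⁻¹ : ℝ) : ℂ) * ‖w‖ ^ 2 + 0 * ((⟪ξ, w⟫ : ℝ) : ℂ))
        - Complex.exp (-((u⁻¹ : ℝ) : ℂ) * ‖w‖ ^ 2 + Complex.I * ((⟪ξ, w⟫ : ℝ) : ℂ))) =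
      (1 - cos ⟪ξ, w⟫) * exp (-(‖w‖ ^ 2 / u)) := by
    intro w
    have e : (-((u⁻¹ : ℝ) : ℂ) * ‖w‖ ^ 2) = ((-(‖w‖ ^ 2 / u) : ℝ) : ℂ) := by
      push_cast; ring
    rw [e, zero_mul, add_zero, Complex.exp_add, ← Complex.ofReal_exp, mul_comm Complex.I,
      Complex.exp_mul_I, ← Complex.ofReal_cos, ← Complex.ofReal_sin]
    simp only [RCLike.re_to_complex, Complex.sub_re, Complex.add_re,
      Complex.ofReal_re, Complex.I_re, Complex.I_im, Complex.ofReal_im, Complex.mul_re]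
    ring
  have hi0 := GaussianFourier.integrable_cexp_neg_mul_sq_norm_add hb 0 ξ
  have hi1 := GaussianFourier.integrable_cexp_neg_mul_sq_norm_add hb Complex.I ξ
  have hi : Integrable fun w : EuclideanSpace ℝ (Fin d) =>
      Complex.exp (-((u⁻¹ : ℝ) : ℂ) * ‖w‖ ^ 2 + 0 * ((⟪ξ, w⟫ : ℝ) : ℂ))
        - Complex.exp (-((u⁻¹ : ℝ) : ℂ) * ‖w‖ ^ 2 + Complex.I * ((⟪ξ, w⟫ : ℝ) : ℂ)) :=
    hi0.sub hi1
  refine ⟨hi.re.congr (Eventually.of_forall key), ?_⟩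
  rw [← integral_congr_ae (Eventually.of_forall key)]
  rw [integral_re hi, integral_sub hi0 hi1,
    GaussianFourier.integral_cexp_neg_mul_sq_norm_add hb,
    GaussianFourier.integral_cexp_neg_mul_sq_norm_add hb]
  have e1 : ((π : ℂ) / ((u⁻¹ : ℝ) : ℂ)) ^ ((Module.finrank ℝ (EuclideanSpace ℝ (Fin d)) : ℂ) / 2)
      = (((π * u) ^ ((d : ℝ) / 2) : ℝ) : ℂ) := by
    rw [Complex.ofReal_cpow (by positivity)]
    simp
  have e2 : Complex.I ^ 2 * (‖ξ‖ : ℂ) ^ 2 / (4 * ((u⁻¹ : ℝ) : ℂ)) =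
      ((-(‖ξ‖ ^ 2 / 4 * u) : ℝ) : ℂ) := by
    rw [Complex.I_sq]
    push_cast
    field_simp
  rw [e1, e2, ← Complex.ofReal_exp]
  simp only [ne_eq, OfNat.ofNat_ne_zero, not_false_eq_true, zero_pow, zero_mul, zero_div,
    Complex.exp_zero, mul_one, RCLike.re_to_complex, Complex.sub_re, Complex.mul_re,
    Complex.ofReal_re, Complex.ofReal_im, sub_zero]
  ring

lemma Aconst_pos {d : ℕ} {α : ℝ} (hα : α ∈ Set.Ioo (0 : ℝ) 2) : 0 < Aconst d α := by
  have h0 := hα.1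
  have h1 : 0 < Gamma (((d : ℝ) + α) / 2) := Gamma_pos_of_pos (by positivity)
  have h2 : 0 < Gamma (1 - α / 2) := Gamma_pos_of_pos (by linarith [hα.2])
  unfold Aconst
  positivity

/-- The characteristic exponent of the isotropic stable Lévy measure. -/
lemma integral_one_sub_cos_mul_rpow {d : ℕ} (hd : 1 ≤ d) {α : ℝ} (hα : α ∈ Set.Ioo (0 : ℝ) 2)
    (ξ : EuclideanSpace ℝ (Fin d)) :
    ∫ w : EuclideanSpace ℝ (Fin d), (1 - cos ⟪ξ, w⟫) * ‖w‖ ^ (-(d : ℝ) - α) =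
      ‖ξ‖ ^ α / Aconst d α := by
  have h0 := hα.1
  have hd0 : (0 : ℝ) < d := by exact_mod_cast hd
  have : Nonempty (Fin d) := ⟨⟨0, hd⟩⟩
  have hp : 0 < ((d : ℝ) + α) / 2 := by positivity
  have hΓ : 0 < Gamma (((d : ℝ) + α) / 2) := Gamma_pos_of_pos hp
  have hΓ2 : 0 < Gamma (1 - α / 2) := Gamma_pos_of_pos (by linarith [hα.2])
  have hcos : ∀ w : EuclideanSpace ℝ (Fin d), 0 ≤ 1 - cos ⟪ξ, w⟫ :=
    fun w => sub_nonneg.2 (cos_le_one _)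
  rw [integral_eq_lintegral_of_nonneg_ae
    (Eventually.of_forall fun w => mul_nonneg (hcos w) (by positivity))
    (Measurable.aestronglyMeasurable (by fun_prop))]
  have inner : ∀ᵐ w : EuclideanSpace ℝ (Fin d),
      ENNReal.ofReal ((1 - cos ⟪ξ, w⟫) * ‖w‖ ^ (-(d : ℝ) - α)) =
      ∫⁻ u in Set.Ioi (0 : ℝ), ENNReal.ofReal (Gamma (((d : ℝ) + α) / 2))⁻¹ *
        ENNReal.ofReal ((1 - cos ⟪ξ, w⟫) *
          (u ^ (-(((d : ℝ) + α) / 2) - 1) * exp (-(‖w‖ ^ 2 / u)))) := by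
    filter_upwards [Measure.ae_ne volume (0 : EuclideanSpace ℝ (Fin d))] with w hw
    have hw' : 0 < ‖w‖ := norm_pos_iff.2 hw
    simp_rw [ENNReal.ofReal_mul (hcos w)]
    rw [lintegral_const_mul _ (by fun_prop), lintegral_const_mul _ (by fun_prop),
      lintegral_rpow_mul_exp_neg_div hp (by positivity), ← rpow_natCast, ← rpow_mul hw'.le,
      ENNReal.ofReal_mul hΓ.le, mul_left_comm, ← mul_assoc (ENNReal.ofReal (Gamma _)⁻¹),
      ← ENNReal.ofReal_mul (inv_nonneg.2 hΓ.le), inv_mul_cancel₀ hΓ.ne', ENNReal.ofReal_one, one_mul]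
    congr 3
    push_cast
    ring
  rw [lintegral_congr_ae inner, lintegral_lintegral_swap (Measurable.aemeasurable (by fun_prop))]
  have outer : ∀ u ∈ Set.Ioi (0 : ℝ),
      ∫⁻ w : EuclideanSpace ℝ (Fin d), ENNReal.ofReal (Gamma (((d : ℝ) + α) / 2))⁻¹ *
        ENNReal.ofReal ((1 - cos ⟪ξ, w⟫) *
          (u ^ (-(((d : ℝ) + α) / 2) - 1) * exp (-(‖w‖ ^ 2 / u)))) =
      ENNReal.ofReal ((Gamma (((d : ℝ) + α) / 2))⁻¹ * π ^ ((d : ℝ) / 2)) *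
        ENNReal.ofReal (u ^ (-(α / 2) - 1) * (1 - exp (-(‖ξ‖ ^ 2 / 4 * u)))) := by
    intro u hu
    have hu' : (0 : ℝ) < u := hu
    obtain ⟨hi, he⟩ := integral_one_sub_cos_mul_gaussian ξ hu'
    rw [lintegral_const_mul _ (by fun_prop)]
    rw [lintegral_congr fun w => by rw [mul_left_comm], ← ofReal_integral_eq_lintegral_ofReal (hi.const_mul _)
      (Eventually.of_forall fun w => by
        have := hcos w
        simp only [Pi.zero_apply]
        positivity), integral_const_mul, he, ← ENNReal.ofReal_mul (by positivity),
        ← ENNReal.ofReal_mul (by positivity)]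
    congr 1
    rw [mul_rpow pi_pos.le hu'.le, show -(α / 2) - 1 = -((d + α) / 2) - 1 + (d : ℝ) / 2 by ring,
      rpow_add hu']
    ring
  rw [setLIntegral_congr_fun measurableSet_Ioi outer, lintegral_const_mul _ (by fun_prop),
    lintegral_rpow_mul_one_sub_exp (by positivity) (by linarith [hα.2]) (by positivity),
    ← ENNReal.ofReal_mul (by positivity), ENNReal.toReal_ofReal (by positivity)]
  have e : (‖ξ‖ ^ 2 / 4) ^ (α / 2) = ‖ξ‖ ^ α / 2 ^ α := by
    rw [show ‖ξ‖ ^ 2 / 4 = (‖ξ‖ / 2) ^ (2 : ℝ) by rw [rpow_two]; ring,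
      ← rpow_mul (by positivity), div_rpow (norm_nonneg _) (by norm_num)]
    congr 2 <;> ring
  rw [e, Aconst, rpow_sub_one (by norm_num : (2 : ℝ) ≠ 0)]
  field_simp

/-- A density on `(0, ∞)` with separate power laws, relative to dimension `d`, at `0` and `∞`. -/
def twoPower (d : ℕ) (A p B q t : ℝ) : ℝ :=
  if t ≤ 1 then A * t ^ (-(d : ℝ) - p) else B * t ^ (-(d : ℝ) - q)

lemma integrable_min_mul_twoPower {d : ℕ} (hd : 1 ≤ d) (A B : ℝ) {p q : ℝ} (hp : p < 2)
    (hq : 0 < q) :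
    Integrable fun w : EuclideanSpace ℝ (Fin d) => min (‖w‖ ^ 2) 1 * twoPower d A p B q ‖w‖ := by
  have : Nonempty (Fin d) := ⟨⟨0, hd⟩⟩
  rw [integrable_fun_norm_addHaar (volume : Measure (EuclideanSpace ℝ (Fin d)))
      (f := fun t : ℝ => min (t ^ 2) 1 * twoPower d A p B q t),
    finrank_euclideanSpace_fin, ← Set.Ioc_union_Ioi_eq_Ioi zero_le_one, integrableOn_union]
  have hpow : ∀ t : ℝ, t ^ (d - 1) = t ^ ((d : ℝ) - 1) := by
    intro t
    rw [← rpow_natCast, Nat.cast_sub hd, Nat.cast_one]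
  constructor
  · have h : IntegrableOn (fun t : ℝ => A * t ^ (1 - p)) (Set.Ioc 0 1) :=
      ((intervalIntegral.intervalIntegrable_rpow' (by linarith)).1).const_mul A
    refine h.congr_fun (fun t ht => ?_) measurableSet_Ioc
    have ht0 : 0 < t := ht.1
    have ht2 : t ^ 2 ≤ 1 := pow_le_one₀ ht0.le ht.2
    simp only [twoPower, if_pos ht.2, min_eq_left ht2, smul_eq_mul]
    rw [hpow t, ← rpow_natCast t 2,
      show 1 - p = (d : ℝ) - 1 + ((2 : ℕ) : ℝ) + (-(d : ℝ) - p) by push_cast; ring,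
      rpow_add ht0, rpow_add ht0]
    ring
  · have h : IntegrableOn (fun t : ℝ => B * t ^ (-1 - q)) (Set.Ioi 1) :=
      (integrableOn_Ioi_rpow_of_lt (by linarith) one_pos).const_mul B
    refine h.congr_fun (fun t ht => ?_) measurableSet_Ioi
    have ht1 : 1 < t := ht
    have ht0 : 0 < t := one_pos.trans ht1
    have ht2 : 1 ≤ t ^ 2 := one_le_pow₀ ht1.le
    simp only [twoPower, if_neg (not_le.2 ht1), min_eq_right ht2, smul_eq_mul]
    rw [hpow t, show -1 - q = (d : ℝ) - 1 + (-(d : ℝ) - q) by ring, rpow_add ht0]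
    ring

lemma integrable_min_mul_rpow {d : ℕ} (hd : 1 ≤ d) {α : ℝ} (hα : α ∈ Set.Ioo (0 : ℝ) 2) :
    Integrable fun w : EuclideanSpace ℝ (Fin d) =>
      min (‖w‖ ^ 2) 1 * ‖w‖ ^ (-(d : ℝ) - α) := by
  simpa [twoPower] using integrable_min_mul_twoPower hd 1 1 hα.2 hα.1

lemma min_sq_nonneg {E : Type*} [NormedAddCommGroup E] (w : E) : 0 ≤ min (‖w‖ ^ 2) 1 :=
  le_min (sq_nonneg _) zero_le_one

lemma abs_one_sub_cos_inner_le {d : ℕ} (ξ w : EuclideanSpace ℝ (Fin d)) :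
    |1 - cos ⟪ξ, w⟫| ≤ 2 * max (‖ξ‖ ^ 2) 1 * min (‖w‖ ^ 2) 1 := by
  rw [abs_of_nonneg (sub_nonneg.2 (cos_le_one _))]
  have h1 := one_sub_sq_div_two_le_cos (x := ⟪ξ, w⟫)
  have h2 := neg_one_le_cos ⟪ξ, w⟫
  have h3 : ⟪ξ, w⟫ ^ 2 ≤ ‖ξ‖ ^ 2 * ‖w‖ ^ 2 := by
    rw [← mul_pow, ← sq_abs]
    exact pow_le_pow_left₀ (abs_nonneg _) (abs_real_inner_le_norm ξ w) 2
  have h4 := mul_le_mul_of_nonneg_right (le_max_left (‖ξ‖ ^ 2) 1) (sq_nonneg ‖w‖)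
  have h5 := le_max_right (‖ξ‖ ^ 2) 1
  rcases min_choice (‖w‖ ^ 2) 1 with h | h <;> rw [h]
  · nlinarith [sq_nonneg ‖w‖, mul_nonneg (sq_nonneg ‖ξ‖) (sq_nonneg ‖w‖)]
  · linarith

lemma measurable_indicator_of_antitoneOn {ν : ℝ → ℝ} (hν_pos : ∀ r : ℝ, 0 < r → 0 < ν r)
    (hν_mono : ∀ r₁ r₂ : ℝ, 0 < r₁ → r₁ ≤ r₂ → ν r₂ ≤ ν r₁) :
    Measurable ((Set.Ioi (0 : ℝ)).indicator ν) := by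
  refine measurable_of_Ioi fun a => ?_
  rcases lt_or_ge a 0 with ha | ha
  · convert MeasurableSet.univ
    refine Set.eq_univ_of_forall fun x => ha.trans_le ?_
    exact Set.indicator_nonneg (fun r hr => (hν_pos r hr).le) x
  · refine Set.OrdConnected.measurableSet ⟨fun x hx y hy z hz => ?_⟩
    have pos : ∀ u, a < (Set.Ioi (0 : ℝ)).indicator ν u → 0 < u := fun u hu => by
      by_contra h
      rw [Set.indicator_of_notMem (by simpa using h)] at hu
      exact absurd hu (not_lt.2 ha)
    have hx0 := pos x hx
    have hz0 : 0 < z := hx0.trans_le hz.1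
    have hy0 : 0 < y := hz0.trans_le hz.2
    simp only [Set.mem_preimage, Set.mem_Ioi] at hy ⊢
    rw [Set.indicator_of_mem (by exact hy0)] at hy
    rw [Set.indicator_of_mem (by exact hz0)]
    exact hy.trans_le (hν_mono z y hz0 hz.2)

lemma aestronglyMeasurable_norm_div {d : ℕ} (hd : 1 ≤ d) {ν : ℝ → ℝ}
    (hν_pos : ∀ r : ℝ, 0 < r → 0 < ν r)
    (hν_mono : ∀ r₁ r₂ : ℝ, 0 < r₁ → r₁ ≤ r₂ → ν r₂ ≤ ν r₁) {ρ : ℝ} (hρ : 0 < ρ) :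
    AEStronglyMeasurable fun w : EuclideanSpace ℝ (Fin d) => ν (‖w‖ / ρ) := by
  have : Nonempty (Fin d) := ⟨⟨0, hd⟩⟩
  have h := (measurable_indicator_of_antitoneOn hν_pos hν_mono).comp
    (measurable_norm.div_const ρ : Measurable fun w : EuclideanSpace ℝ (Fin d) => ‖w‖ / ρ)
  refine h.aestronglyMeasurable.congr ?_
  filter_upwards [Measure.ae_ne volume (0 : EuclideanSpace ℝ (Fin d))] with w hw
  exact Set.indicator_of_mem (div_pos (norm_pos_iff.2 hw) hρ) ν

/-- A Potter-type bound for a nonincreasing regularly varying function. -/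
lemma exists_forall_le_rpow_mul {ν : ℝ → ℝ} (hν_pos : ∀ r : ℝ, 0 < r → 0 < ν r)
    (hν_mono : ∀ r₁ r₂ : ℝ, 0 < r₁ → r₁ ≤ r₂ → ν r₂ ≤ ν r₁) {p q : ℝ} (hq : 0 < q) (hqp : q < p)
    (h2 : Tendsto (fun r : ℝ => ν (2 * r) / ν r) atTop (nhds ((2 : ℝ) ^ (-p)))) :
    ∃ x₀ > 0, ∀ x ≥ x₀, ∀ t ≥ 1, ν (t * x) ≤ 2 ^ q * t ^ (-q) * ν x := by
  have hlt : (2 : ℝ) ^ (-p) < 2 ^ (-q) := rpow_lt_rpow_of_exponent_lt one_lt_two (by linarith)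
  obtain ⟨x₁, hx₁⟩ := eventually_atTop.1 (h2.eventually_lt_const hlt)
  refine ⟨max x₁ 1, by positivity, fun x hx t ht => ?_⟩
  have hx0 : 0 < x := lt_of_lt_of_le (by positivity) hx
  have hpow : ∀ k : ℕ, ν (2 ^ k * x) ≤ ((2 : ℝ) ^ (-q)) ^ k * ν x := by
    intro k
    induction k with
    | zero => simp
    | succ k ih =>
      have hk : 0 < (2 : ℝ) ^ k * x := by positivity
      have hk1 : x₁ ≤ 2 ^ k * x :=
        ((le_max_left _ _).trans hx).trans (le_mul_of_one_le_left hx0.le (one_le_pow₀ one_le_two))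
      have h := (div_lt_iff₀ (hν_pos _ hk)).1 (hx₁ _ hk1)
      calc ν (2 ^ (k + 1) * x) = ν (2 * (2 ^ k * x)) := by ring_nf
        _ ≤ 2 ^ (-q) * ν (2 ^ k * x) := h.le
        _ ≤ 2 ^ (-q) * (((2 : ℝ) ^ (-q)) ^ k * ν x) := by gcongr
        _ = _ := by ring
  obtain ⟨k, hk1, hk2⟩ := exists_nat_pow_near ht one_lt_two
  have ht0 : 0 < t := one_pos.trans_le ht
  refine (hν_mono (2 ^ k * x) (t * x) (by positivity) (by gcongr)).trans ((hpow k).trans ?_)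
  refine mul_le_mul_of_nonneg_right ?_ (hν_pos x hx0).le
  have hkt : t / 2 ≤ 2 ^ k := by rw [pow_succ] at hk2; linarith
  calc ((2 : ℝ) ^ (-q)) ^ k = ((2 : ℝ) ^ k) ^ (-q) := by
        rw [← rpow_natCast, ← rpow_natCast, ← rpow_mul two_pos.le, ← rpow_mul two_pos.le, mul_comm]
    _ ≤ (t / 2) ^ (-q) := rpow_le_rpow_of_nonpos (by positivity) hkt (by linarith)
    _ = 2 ^ q * t ^ (-q) := by
        rw [div_rpow ht0.le two_pos.le, rpow_neg two_pos.le]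
        field_simp

lemma eventually_div_le_twoPower {d : ℕ} {ν : ℝ → ℝ} (hν_pos : ∀ r : ℝ, 0 < r → 0 < ν r)
    (hν_mono : ∀ r₁ r₂ : ℝ, 0 < r₁ → r₁ ≤ r₂ → ν r₂ ≤ ν r₁) {β M : ℝ} (hM : 1 < M)
    (hA1 : ∀ r₁ r₂ : ℝ, 0 < r₁ → r₁ < r₂ → ν r₁ ≤ M * (r₂ / r₁) ^ ((d:ℝ) + β) * ν r₂)
    {α : ℝ} (hα : α ∈ Set.Ioo (0:ℝ) 2)
    (hA2 : ∀ lam : ℝ, 0 < lam →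
      Tendsto (fun r : ℝ => ν (lam * r) / ν r) atTop (nhds (lam ^ (-(d:ℝ) - α)))) :
    ∀ᶠ ρ in nhdsWithin (0 : ℝ) (Set.Ioi 0), ∀ t > 0,
      ν (t / ρ) / ν (1 / ρ) ≤ twoPower d M β (2 ^ ((d : ℝ) + α / 2)) (α / 2) t := by
  have hα0 := hα.1
  obtain ⟨x₀, hx₀, hP⟩ := exists_forall_le_rpow_mul hν_pos hν_mono (p := d + α)
    (q := d + α / 2) (by positivity) (by linarith)
    (by rw [neg_add']; exact hA2 2 two_pos)
  filter_upwards [self_mem_nhdsWithin, tendsto_inv_nhdsGT_zero.eventually_ge_atTop x₀]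
    with ρ hρ hρx t ht
  have hρ0 : 0 < ρ := hρ
  rw [div_le_iff₀ (hν_pos _ (by positivity)), twoPower]
  split_ifs with h
  · rcases h.lt_or_eq with h | rfl
    · refine (hA1 (t / ρ) (1 / ρ) (by positivity) (by gcongr)).trans_eq ?_
      rw [div_div_div_cancel_right₀ hρ0.ne', one_div, inv_rpow ht.le, ← rpow_neg ht.le, neg_add']
    · simpa using le_mul_of_one_le_left (hν_pos _ (by positivity)).le hM.le
  · have := hP ρ⁻¹ hρx t (not_le.1 h).le
    rwa [neg_add', ← div_eq_mul_inv, ← one_div ρ] at this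

/-- Weighted `L¹` convergence of the rescaled Lévy densities to the stable one. -/
lemma tendsto_integral_min_mul_abs_sub {d : ℕ} (hd : 1 ≤ d) {ν : ℝ → ℝ}
    (hν_pos : ∀ r : ℝ, 0 < r → 0 < ν r)
    (hν_mono : ∀ r₁ r₂ : ℝ, 0 < r₁ → r₁ ≤ r₂ → ν r₂ ≤ ν r₁)
    {β M : ℝ} (hβ : β < 2) (hM : 1 < M)
    (hA1 : ∀ r₁ r₂ : ℝ, 0 < r₁ → r₁ < r₂ → ν r₁ ≤ M * (r₂ / r₁) ^ ((d:ℝ) + β) * ν r₂)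
    {α : ℝ} (hα : α ∈ Set.Ioo (0:ℝ) 2)
    (hA2 : ∀ lam : ℝ, 0 < lam →
      Tendsto (fun r : ℝ => ν (lam * r) / ν r) atTop (nhds (lam ^ (-(d:ℝ) - α)))) :
    (∀ᶠ ρ in nhdsWithin (0 : ℝ) (Set.Ioi 0),
      Integrable fun w : EuclideanSpace ℝ (Fin d) =>
        min (‖w‖ ^ 2) 1 * (ν (‖w‖ / ρ) / ν (1 / ρ))) ∧
    Tendsto (fun ρ : ℝ => ∫ w : EuclideanSpace ℝ (Fin d),
      min (‖w‖ ^ 2) 1 * |ν (‖w‖ / ρ) / ν (1 / ρ) - ‖w‖ ^ (-(d : ℝ) - α)|)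
      (nhdsWithin (0 : ℝ) (Set.Ioi 0)) (nhds 0) := by
  have : Nonempty (Fin d) := ⟨⟨0, hd⟩⟩
  have hne := Measure.ae_ne volume (0 : EuclideanSpace ℝ (Fin d))
  have hb := eventually_div_le_twoPower hν_pos hν_mono hM hA1 hα hA2
  have hB := integrable_min_mul_twoPower hd M (2 ^ ((d : ℝ) + α / 2)) hβ (half_pos hα.1)
  have hS := integrable_min_mul_rpow hd hα
  have hmeas : ∀ ρ : ℝ, 0 < ρ → AEStronglyMeasurable fun w : EuclideanSpace ℝ (Fin d) =>
      ν (‖w‖ / ρ) / ν (1 / ρ) := fun ρ hρ =>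
    (aestronglyMeasurable_norm_div hd hν_pos hν_mono hρ).div₀ aestronglyMeasurable_const
  have hmin : AEStronglyMeasurable fun w : EuclideanSpace ℝ (Fin d) => min (‖w‖ ^ 2) 1 :=
    Measurable.aestronglyMeasurable (by fun_prop)
  have hrpow : AEStronglyMeasurable fun w : EuclideanSpace ℝ (Fin d) => ‖w‖ ^ (-(d : ℝ) - α) :=
    Measurable.aestronglyMeasurable (by fun_prop)
  constructor
  · filter_upwards [hb, self_mem_nhdsWithin] with ρ h hρ
    have hρ0 : 0 < ρ := hρ
    refine hB.mono' (hmin.mul (hmeas ρ hρ0)) ?_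
    filter_upwards [hne] with w hw
    have hw0 := norm_pos_iff.2 hw
    have h1 := hν_pos (‖w‖ / ρ) (by positivity)
    have h2 := hν_pos (1 / ρ) (by positivity)
    rw [norm_of_nonneg (mul_nonneg (min_sq_nonneg w) (by positivity))]
    exact mul_le_mul_of_nonneg_left (h _ hw0) (min_sq_nonneg w)
  · rw [show nhds (0 : ℝ) = nhds (∫ _ : EuclideanSpace ℝ (Fin d), (0 : ℝ)) by simp]
    refine tendsto_integral_filter_of_dominated_convergence _ ?_ ?_ (hB.add hS) ?_
    · filter_upwards [self_mem_nhdsWithin] with ρ hρ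
      exact hmin.mul ((hmeas ρ hρ).sub hrpow).norm
    · filter_upwards [hb, self_mem_nhdsWithin] with ρ h hρ
      have hρ0 : 0 < ρ := hρ
      filter_upwards [hne] with w hw
      have hw0 := norm_pos_iff.2 hw
      have h1 := hν_pos (‖w‖ / ρ) (by positivity)
      have h2 := hν_pos (1 / ρ) (by positivity)
      have h3 : 0 ≤ ‖w‖ ^ (-(d : ℝ) - α) := by positivity
      have h4 : 0 ≤ ν (‖w‖ / ρ) / ν (1 / ρ) := by positivity
      rw [norm_of_nonneg (mul_nonneg (min_sq_nonneg w) (abs_nonneg _)), Pi.add_apply, ← mul_add]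
      refine mul_le_mul_of_nonneg_left ?_ (min_sq_nonneg w)
      rw [abs_le]
      constructor <;> linarith [h _ hw0]
    · filter_upwards [hne] with w hw
      have h : Tendsto (fun ρ : ℝ => ν (‖w‖ / ρ) / ν (1 / ρ)) (nhdsWithin (0 : ℝ) (Set.Ioi 0))
          (nhds (‖w‖ ^ (-(d : ℝ) - α))) := by
        simpa only [Function.comp_def, div_eq_mul_inv, one_mul] using
          (hA2 ‖w‖ (norm_pos_iff.2 hw)).comp tendsto_inv_nhdsGT_zero
      simpa using ((h.sub_const (‖w‖ ^ (-(d : ℝ) - α))).abs).const_mul (min (‖w‖ ^ 2) 1)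

lemma integrable_mul_of_abs_le {d : ℕ} {k f : EuclideanSpace ℝ (Fin d) → ℝ} {C : ℝ}
    (hk : AEStronglyMeasurable k) (hf : AEStronglyMeasurable f)
    (hkC : ∀ w, |k w| ≤ C * min (‖w‖ ^ 2) 1)
    (hi : Integrable fun w => min (‖w‖ ^ 2) 1 * f w) : Integrable fun w => k w * f w := by
  refine (hi.norm.const_mul C).mono' (hk.mul hf) (Eventually.of_forall fun w => ?_)
  rw [norm_mul, norm_mul, ← mul_assoc, norm_of_nonneg (min_sq_nonneg w)]
  exact mul_le_mul_of_nonneg_right (hkC w) (norm_nonneg _)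

lemma abs_integral_mul_sub_le {d : ℕ} {k f g : EuclideanSpace ℝ (Fin d) → ℝ} {C : ℝ}
    (hk : AEStronglyMeasurable k) (hf : AEStronglyMeasurable f) (hg : AEStronglyMeasurable g)
    (hkC : ∀ w, |k w| ≤ C * min (‖w‖ ^ 2) 1)
    (hif : Integrable fun w => min (‖w‖ ^ 2) 1 * f w)
    (hig : Integrable fun w => min (‖w‖ ^ 2) 1 * g w) :
    |(∫ w, k w * f w) - ∫ w, k w * g w| ≤ C * ∫ w, min (‖w‖ ^ 2) 1 * |f w - g w| := by
  rw [← integral_sub (integrable_mul_of_abs_le hk hf hkC hif)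
    (integrable_mul_of_abs_le hk hg hkC hig), ← integral_const_mul]
  have hi : Integrable fun w => min (‖w‖ ^ 2) 1 * |f w - g w| := by
    refine (hif.sub hig).norm.congr (Eventually.of_forall fun w => ?_)
    simp only [Pi.sub_apply]
    rw [← mul_sub, norm_mul, norm_of_nonneg (min_sq_nonneg w), norm_eq_abs]
  rw [← norm_eq_abs]
  refine norm_integral_le_of_norm_le (hi.const_mul C) (Eventually.of_forall fun w => ?_)
  rw [← mul_sub, norm_mul, ← mul_assoc]
  exact mul_le_mul_of_nonneg_right (hkC w) (abs_nonneg _)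

lemma ψ_smul {d : ℕ} {ν : ℝ → ℝ} (hν_pos : ∀ r : ℝ, 0 < r → 0 < ν r) {ρ : ℝ} (hρ : 0 < ρ)
    (ξ : EuclideanSpace ℝ (Fin d)) :
    ψ d ν (ρ • ξ) = ν (1 / ρ) / ρ ^ d *
      ∫ w : EuclideanSpace ℝ (Fin d), (1 - cos ⟪ξ, w⟫) * (ν (‖w‖ / ρ) / ν (1 / ρ)) := by
  have hν := (hν_pos (1 / ρ) (by positivity)).ne'
  have h := Measure.integral_comp_smul (volume : Measure (EuclideanSpace ℝ (Fin d)))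
    (fun w => (1 - cos ⟪ξ, w⟫) * (ν (‖w‖ / ρ) / ν (1 / ρ))) ρ
  rw [finrank_euclideanSpace_fin, abs_of_pos (by positivity), smul_eq_mul] at h
  rw [div_eq_mul_inv (ν _), mul_assoc, ← h, ← integral_const_mul, ψ]
  refine integral_congr_ae (Eventually.of_forall fun w => ?_)
  simp only [norm_smul, real_inner_smul_left, real_inner_smul_right, norm_of_nonneg hρ.le]
  rw [mul_div_cancel_left₀ _ hρ.ne']
  field_simp

lemma continuous_ψ {d : ℕ} (hd : 1 ≤ d) {ν : ℝ → ℝ} (hν_pos : ∀ r : ℝ, 0 < r → 0 < ν r)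
    (hν_mono : ∀ r₁ r₂ : ℝ, 0 < r₁ → r₁ ≤ r₂ → ν r₂ ≤ ν r₁)
    (hint : Integrable (fun z : EuclideanSpace ℝ (Fin d) => min (‖z‖ ^ 2) 1 * ν ‖z‖)) :
    Continuous (ψ d ν) := by
  have hm : AEStronglyMeasurable fun w : EuclideanSpace ℝ (Fin d) => ν ‖w‖ := by
    simpa using aestronglyMeasurable_norm_div hd hν_pos hν_mono one_pos
  refine continuous_iff_continuousAt.2 fun ξ₀ => ?_
  refine continuousAt_of_dominated
    (bound := fun z => 2 * max ((‖ξ₀‖ + 1) ^ 2) 1 * ‖min (‖z‖ ^ 2) 1 * ν ‖z‖‖) ?_ ?_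
    (hint.norm.const_mul _) ?_
  · exact Eventually.of_forall fun ξ =>
      (Measurable.aestronglyMeasurable (by fun_prop)).mul hm
  · have h : ∀ᶠ ξ in nhds ξ₀, ‖ξ‖ < ‖ξ₀‖ + 1 :=
      continuous_norm.continuousAt.eventually_lt_const (lt_add_one ‖ξ₀‖)
    filter_upwards [h] with ξ hξ
    refine Eventually.of_forall fun w => ?_
    rw [norm_mul, norm_mul, ← mul_assoc, norm_of_nonneg (min_sq_nonneg w)]
    refine mul_le_mul_of_nonneg_right ((abs_one_sub_cos_inner_le ξ w).trans ?_) (norm_nonneg _)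
    have := min_sq_nonneg w
    gcongr
  · exact Eventually.of_forall fun w => Continuous.continuousAt (by fun_prop)

lemma ψstar_eq_sSup_image {d : ℕ} {ν : ℝ → ℝ} {r : ℝ} (hr : 0 ≤ r) :
    ψstar d ν r = sSup ((fun ξ => ψ d ν (r • ξ)) '' Metric.closedBall 0 1) := by
  rw [ψstar]
  congr 1
  ext y
  constructor
  · rintro ⟨z, hz, rfl⟩
    rcases hr.eq_or_lt with rfl | hr
    · exact ⟨0, by simp, by simp [norm_le_zero_iff.1 hz]⟩
    · refine ⟨r⁻¹ • z, ?_, by simp [smul_smul, hr.ne']⟩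
      rw [mem_closedBall_zero_iff, norm_smul, norm_of_nonneg (by positivity), inv_mul_le_iff₀ hr]
      simpa using hz
  · rintro ⟨ξ, hξ, rfl⟩
    refine ⟨r • ξ, ?_, rfl⟩
    rw [norm_smul, norm_of_nonneg hr]
    exact mul_le_of_le_one_right hr (mem_closedBall_zero_iff.1 hξ)

lemma continuousOn_ψstar {d : ℕ} {ν : ℝ → ℝ} (hψ : Continuous (ψ d ν)) :
    ContinuousOn (ψstar d ν) (Set.Ici 0) := by
  have h : Continuous fun r : ℝ =>
      sSup ((fun ξ => ψ d ν (r • ξ)) '' Metric.closedBall 0 1) :=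
    (isCompact_closedBall (0 : EuclideanSpace ℝ (Fin d)) 1).continuous_sSup
      (f := fun (r : ℝ) ξ => ψ d ν (r • ξ)) (hψ.comp (continuous_fst.smul continuous_snd))
  exact h.continuousOn.congr fun r hr => ψstar_eq_sSup_image hr

lemma ψ_le_ψstar {d : ℕ} {ν : ℝ → ℝ} (hψ : Continuous (ψ d ν)) {r : ℝ}
    {ξ : EuclideanSpace ℝ (Fin d)} (hξ : ‖ξ‖ ≤ r) : ψ d ν ξ ≤ ψstar d ν r := by
  refine le_csSup ?_ ⟨ξ, hξ, rfl⟩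
  refine ((isCompact_closedBall (0 : EuclideanSpace ℝ (Fin d)) r).bddAbove_image
    hψ.continuousOn).mono ?_
  rintro y ⟨z, hz, rfl⟩
  exact ⟨z, by simpa using hz, rfl⟩

lemma ψstar_mono {d : ℕ} {ν : ℝ → ℝ} (hψ : Continuous (ψ d ν)) {r₁ r₂ : ℝ} (h0 : 0 ≤ r₁)
    (h : r₁ ≤ r₂) : ψstar d ν r₁ ≤ ψstar d ν r₂ := by
  refine csSup_le ⟨ψ d ν 0, 0, by simpa using h0, rfl⟩ ?_
  rintro y ⟨z, hz, rfl⟩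
  exact ψ_le_ψstar hψ (hz.trans h)

lemma ψstar_zero (d : ℕ) (ν : ℝ → ℝ) : ψstar d ν 0 = 0 := by
  simp [ψstar_eq_sSup_image le_rfl, ψ]

lemma ψinv_spec {d : ℕ} {ν : ℝ → ℝ} (hψ : Continuous (ψ d ν)) {u : ℝ} (hu : 0 < u)
    (hu1 : u < ψstar d ν 1) : 0 < ψinv d ν u ∧ ψstar d ν (ψinv d ν u) = u := by
  have hc := continuousOn_ψstar hψ
  have hne : {r : ℝ | 0 ≤ r ∧ ψstar d ν r = u}.Nonempty := by
    obtain ⟨r, hr, h⟩ := intermediate_value_Icc zero_le_one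
      (hc.mono Set.Icc_subset_Ici_self) ⟨(ψstar_zero d ν).trans_le hu.le, hu1.le⟩
    exact ⟨r, hr.1, h⟩
  have hbdd : BddAbove {r : ℝ | 0 ≤ r ∧ ψstar d ν r = u} := by
    refine ⟨1, fun r hr => ?_⟩
    by_contra! h
    exact absurd (hr.2 ▸ ψstar_mono hψ zero_le_one h.le) (not_le.2 hu1)
  have hcl : IsClosed {r : ℝ | 0 ≤ r ∧ ψstar d ν r = u} :=
    hc.preimage_isClosed_of_isClosed isClosed_Ici (isClosed_singleton (x := u))
  obtain ⟨h0, h⟩ := hcl.csSup_mem hne hbdd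
  refine ⟨lt_of_le_of_ne h0 fun h' => ?_, h⟩
  change ψstar d ν (ψinv d ν u) = u at h
  rw [← h', ψstar_zero] at h
  exact hu.ne h

lemma tendsto_ψinv_one_div {d : ℕ} {ν : ℝ → ℝ} (hψ : Continuous (ψ d ν))
    (hpos : ∀ r > 0, 0 < ψstar d ν r) :
    Tendsto (fun s : ℝ => ψinv d ν (1 / s)) atTop (nhdsWithin 0 (Set.Ioi 0)) := by
  have hsmall : ∀ r > 0, ∀ᶠ s : ℝ in atTop, 0 < 1 / s ∧ 1 / s < ψstar d ν r := by
    intro r hr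
    have h : Tendsto (fun s : ℝ => 1 / s) atTop (nhds 0) := tendsto_const_nhds.div_atTop tendsto_id
    filter_upwards [eventually_gt_atTop 0, h.eventually_lt_const (hpos r hr)] with s h0 h1
    exact ⟨one_div_pos.2 h0, h1⟩
  refine tendsto_nhdsWithin_iff.2 ⟨?_, ?_⟩
  · refine tendsto_order.2 ⟨fun a ha => ?_, fun a ha => ?_⟩
    · filter_upwards [hsmall 1 one_pos] with s hs
      exact ha.trans (ψinv_spec hψ hs.1 hs.2).1
    · filter_upwards [hsmall 1 one_pos, hsmall a ha] with s hs hsa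
      by_contra! h
      have := ψstar_mono hψ ha.le h
      rw [(ψinv_spec hψ hs.1 hs.2).2] at this
      exact absurd hsa.2 (not_lt.2 this)
  · filter_upwards [hsmall 1 one_pos] with s hs
    exact (ψinv_spec hψ hs.1 hs.2).1

/-- `ψ*(ρ)` is asymptotic to `ρ⁻ᵈ ν(1/ρ) / 𝒜(d,α)` at the origin. -/
lemma tendsto_ψstar_div {d : ℕ} (hd : 1 ≤ d) {ν : ℝ → ℝ}
    (hν_pos : ∀ r : ℝ, 0 < r → 0 < ν r)
    (hν_mono : ∀ r₁ r₂ : ℝ, 0 < r₁ → r₁ ≤ r₂ → ν r₂ ≤ ν r₁)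
    (hψ : Continuous (ψ d ν))
    {β M : ℝ} (hβ : β < 2) (hM : 1 < M)
    (hA1 : ∀ r₁ r₂ : ℝ, 0 < r₁ → r₁ < r₂ → ν r₁ ≤ M * (r₂ / r₁) ^ ((d:ℝ) + β) * ν r₂)
    {α : ℝ} (hα : α ∈ Set.Ioo (0:ℝ) 2)
    (hA2 : ∀ lam : ℝ, 0 < lam →
      Tendsto (fun r : ℝ => ν (lam * r) / ν r) atTop (nhds (lam ^ (-(d:ℝ) - α)))) :
    Tendsto (fun ρ => ψstar d ν ρ / (ν (1 / ρ) / ρ ^ d)) (nhdsWithin (0 : ℝ) (Set.Ioi 0))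
      (nhds (Aconst d α)⁻¹) := by
  obtain ⟨hi, hE⟩ := tendsto_integral_min_mul_abs_sub hd hν_pos hν_mono hβ hM hA1 hα hA2
  have hA := Aconst_pos (d := d) hα
  have hS := integrable_min_mul_rpow hd hα
  set e : EuclideanSpace ℝ (Fin d) := EuclideanSpace.single ⟨0, hd⟩ 1
  have he : ‖e‖ = 1 := by simp [e]
  have hlo := (hE.const_mul 2).const_sub (Aconst d α)⁻¹
  have hhi := (hE.const_mul 2).const_add (Aconst d α)⁻¹
  rw [mul_zero, sub_zero] at hlo
  rw [mul_zero, add_zero] at hhi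
  have key : ∀ᶠ ρ in nhdsWithin (0 : ℝ) (Set.Ioi 0), ∀ ξ : EuclideanSpace ℝ (Fin d), ‖ξ‖ ≤ 1 →
      |ψ d ν (ρ • ξ) / (ν (1 / ρ) / ρ ^ d) - ‖ξ‖ ^ α / Aconst d α| ≤
        2 * ∫ w : EuclideanSpace ℝ (Fin d),
          min (‖w‖ ^ 2) 1 * |ν (‖w‖ / ρ) / ν (1 / ρ) - ‖w‖ ^ (-(d : ℝ) - α)| := by
    filter_upwards [hi, self_mem_nhdsWithin] with ρ hρi hρ ξ hξ
    have hρ0 : 0 < ρ := hρ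
    have hν := hν_pos (1 / ρ) (by positivity)
    rw [ψ_smul hν_pos hρ0, mul_div_cancel_left₀ _ (by positivity),
      ← integral_one_sub_cos_mul_rpow hd hα ξ]
    refine abs_integral_mul_sub_le (Measurable.aestronglyMeasurable (by fun_prop))
      ((aestronglyMeasurable_norm_div hd hν_pos hν_mono hρ0).div₀ aestronglyMeasurable_const)
      (Measurable.aestronglyMeasurable (by fun_prop)) (fun w => ?_) hρi hS
    refine (abs_one_sub_cos_inner_le ξ w).trans_eq ?_
    rw [max_eq_right (pow_le_one₀ (norm_nonneg _) hξ), mul_one]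
  refine tendsto_of_tendsto_of_tendsto_of_le_of_le' hlo hhi ?_ ?_
  · filter_upwards [key, self_mem_nhdsWithin] with ρ h hρ
    have hρ0 : 0 < ρ := hρ
    have hν := hν_pos (1 / ρ) (by positivity)
    have h1 := (abs_le.1 (h e he.le)).1
    rw [he, one_rpow, one_div (Aconst d α)] at h1
    have h2 : ψ d ν (ρ • e) / (ν (1 / ρ) / ρ ^ d) ≤ ψstar d ν ρ / (ν (1 / ρ) / ρ ^ d) := by
      gcongr
      exact ψ_le_ψstar hψ (by rw [norm_smul, he, norm_of_nonneg hρ0.le, mul_one])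
    linarith
  · filter_upwards [key, self_mem_nhdsWithin] with ρ h hρ
    have hρ0 : 0 < ρ := hρ
    have hν := hν_pos (1 / ρ) (by positivity)
    rw [div_le_iff₀ (by positivity), ψstar_eq_sSup_image hρ0.le]
    refine csSup_le ⟨_, 0, by simp, rfl⟩ ?_
    rintro y ⟨ξ, hξ, rfl⟩
    rw [mem_closedBall_zero_iff] at hξ
    rw [← div_le_iff₀ (by positivity)]
    have h1 := (abs_le.1 (h ξ hξ)).2
    have h2 : ‖ξ‖ ^ α / Aconst d α ≤ (Aconst d α)⁻¹ := by
      rw [div_eq_mul_inv]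
      exact mul_le_of_le_one_left (by positivity)
        (rpow_le_one (norm_nonneg _) hξ hα.1.le)
    linarith

theorem statement10
    (d : ℕ) (hd : 1 ≤ d) (ν : ℝ → ℝ)
    (hν_pos : ∀ r : ℝ, 0 < r → 0 < ν r)
    (hν_mono : ∀ r₁ r₂ : ℝ, 0 < r₁ → r₁ ≤ r₂ → ν r₂ ≤ ν r₁)
    (hint : Integrable (fun z : EuclideanSpace ℝ (Fin d) => min (‖z‖ ^ 2) 1 * ν ‖z‖))
    (hninf : ¬ Integrable (fun z : EuclideanSpace ℝ (Fin d) => ν ‖z‖))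
    (β M : ℝ) (hβ : β ∈ Set.Ioo (0:ℝ) 2) (hM : 1 < M)
    (hA1 : ∀ r₁ r₂ : ℝ, 0 < r₁ → r₁ < r₂ → ν r₁ ≤ M * (r₂ / r₁) ^ ((d:ℝ) + β) * ν r₂)
    (α : ℝ) (hα : α ∈ Set.Ioo (0:ℝ) 2)
    (hA2 : ∀ lam : ℝ, 0 < lam →
      Tendsto (fun r : ℝ => ν (lam * r) / ν r) atTop (nhds (lam ^ (-(d:ℝ) - α))))
    (hnorm : ∀ ξ : EuclideanSpace ℝ (Fin d), ‖ξ‖ = 1 → ψ d ν ξ = 1)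
:
    ∀ r : ℝ, 0 < r →
      Tendsto (fun s : ℝ =>
          ∫ z : EuclideanSpace ℝ (Fin d), min (‖z‖ ^ 2 / r ^ 2) 1 * νs d ν s z) atTop
        (nhds (∫ z : EuclideanSpace ℝ (Fin d),
          min (‖z‖ ^ 2 / r ^ 2) 1 * (Aconst d α * ‖z‖ ^ (-(d:ℝ) - α)))) := by
  have hψ := continuous_ψ hd hν_pos hν_mono hint
  obtain ⟨hi, hE⟩ := tendsto_integral_min_mul_abs_sub hd hν_pos hν_mono hβ.2 hM hA1 hα hA2
  have hlim := tendsto_ψstar_div hd hν_pos hν_mono hψ hβ.2 hM hA1 hα hA2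
  have hA := Aconst_pos (d := d) hα
  have hS := integrable_min_mul_rpow hd hα
  have hpos : ∀ r > 0, 0 < ψstar d ν r := by
    intro r hr
    obtain ⟨ρ, hρ, hρr, hρ0⟩ := ((hlim.eventually_const_lt (inv_pos.2 hA)).and
      ((eventually_nhdsWithin_of_eventually_nhds (eventually_lt_nhds hr)).and
        self_mem_nhdsWithin)).exists
    have hρ0' : 0 < ρ := hρ0
    have hν := hν_pos (1 / ρ) (by positivity)
    have := (div_pos_iff_of_pos_right (by positivity)).1 hρ
    exact this.trans_le (ψstar_mono hψ hρ0'.le hρr.le)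
  have hto := tendsto_ψinv_one_div hψ hpos
  intro r hr
  have hkC : ∀ w : EuclideanSpace ℝ (Fin d),
      |min (‖w‖ ^ 2 / r ^ 2) 1| ≤ max (1 / r ^ 2) 1 * min (‖w‖ ^ 2) 1 := by
    intro w
    rw [abs_of_nonneg (by positivity)]
    rcases min_choice (‖w‖ ^ 2) 1 with h | h <;> rw [h]
    · refine (min_le_left _ _).trans ?_
      rw [div_eq_inv_mul, ← one_div]
      gcongr
      exact le_max_left _ _
    · rw [mul_one]
      exact (min_le_right _ _).trans (le_max_right _ _)
  have hk : Tendsto (fun ρ : ℝ => ∫ w : EuclideanSpace ℝ (Fin d),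
      min (‖w‖ ^ 2 / r ^ 2) 1 * (ν (‖w‖ / ρ) / ν (1 / ρ))) (nhdsWithin 0 (Set.Ioi 0))
      (nhds (∫ w : EuclideanSpace ℝ (Fin d),
        min (‖w‖ ^ 2 / r ^ 2) 1 * ‖w‖ ^ (-(d : ℝ) - α))) := by
    rw [tendsto_iff_norm_sub_tendsto_zero]
    refine squeeze_zero' (Eventually.of_forall fun _ => norm_nonneg _) ?_
      (by simpa only [mul_zero] using hE.const_mul (max (1 / r ^ 2) 1))
    filter_upwards [hi, self_mem_nhdsWithin] with ρ hρi hρ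
    exact abs_integral_mul_sub_le (Measurable.aestronglyMeasurable (by fun_prop))
      ((aestronglyMeasurable_norm_div hd hν_pos hν_mono hρ).div₀ aestronglyMeasurable_const)
      (Measurable.aestronglyMeasurable (by fun_prop)) hkC hρi hS
  have hmain := ((hlim.inv₀ (inv_ne_zero hA.ne')).mul hk).comp hto
  rw [inv_inv, ← integral_const_mul] at hmain
  simp_rw [mul_left_comm _ (Aconst d α)]
  refine hmain.congr' ?_
  have hsmall : Tendsto (fun s : ℝ => 1 / s) atTop (nhds 0) :=
    tendsto_const_nhds.div_atTop tendsto_id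
  filter_upwards [eventually_gt_atTop 0, hsmall.eventually_lt_const (hpos 1 one_pos)] with s h0 h1
  obtain ⟨hρ, hρs⟩ := ψinv_spec hψ (one_div_pos.2 h0) h1
  simp only [Function.comp_apply, hρs, νs]
  have hν := hν_pos (1 / ψinv d ν (1 / s)) (by positivity)
  rw [← integral_const_mul]
  refine integral_congr_ae (Eventually.of_forall fun w => ?_)
  field_simp

end
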